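/- Let I be an irreducible upper set of a finite poset P. Then χ_I is a prime element of M(P) if and only if both of the following hold: (1) for all irreducible upper sets G, H of P with G ≠ I and H ≠ I, χ_I does not divide χ_{G∪H} and χ_I does not divide χ_{G∩H} in M(P); and (2) for every irreducible upper set J ≠ I, the pair {I, J} is a near-chain, i.e., I ⊆ J, J ⊆ I, or I ∩ J = ∅. -/

import Mathlib

/-- An irreducible upper set: a nonempty upper set that is not the union of two
disjoint nonempty upper sets. -/
def IrredUpper {P : Type*} [PartialOrder P] (I : Set P) : Prop :=
  IsUpperSet I ∧ I.Nonempty ∧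
    ∀ A B : Set P, IsUpperSet A → IsUpperSet B → A.Nonempty → B.Nonempty →
      Disjoint A B → I ≠ A ∪ B

/-- `f` divides `g` in the monoid `M(P)` of monotone functions `P → ℕ`. -/
def DividesM {P : Type*} [PartialOrder P] (f g : P → ℕ) : Prop :=
  ∃ h : P → ℕ, Monotone h ∧ g = f + h

/-- `f` is a prime element of the monoid `M(P)` of monotone functions `P → ℕ`. -/
def PrimeM {P : Type*} [PartialOrder P] (f : P → ℕ) : Prop :=
  Monotone f ∧ f ≠ 0 ∧ ∀ g h : P → ℕ, Monotone g → Monotone h →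
    DividesM f (g + h) → DividesM f g ∨ DividesM f h

open Classical in
lemma dividesM_iff {P : Type*} [PartialOrder P] {I : Set P} (hI : IsUpperSet I) {g : P → ℕ}
    (hg : Monotone g) : DividesM (Set.indicator I (1 : P → ℕ)) g ↔
      (∀ y ∈ I, 1 ≤ g y) ∧ ∀ x y, x ≤ y → x ∉ I → y ∈ I → g x < g y := by
  constructor
  · rintro ⟨h, hh, rfl⟩
    refine ⟨fun y hy => by simp [hy], fun x y hxy hx hy => ?_⟩
    have := hh hxy
    simp [hx, hy]
    omega
  · rintro ⟨h1, h2⟩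
    refine ⟨fun x => g x - Set.indicator I (1 : P → ℕ) x, fun x y hxy => ?_, ?_⟩
    · have h3 := hg hxy
      by_cases hx : x ∈ I
      · have hy := hI hxy hx
        simp [hx, hy]; omega
      · by_cases hy : y ∈ I
        · have := h2 x y hxy hx hy
          simp [hx, hy]; omega
        · simpa [hx, hy] using h3
    · funext x
      by_cases hx : x ∈ I
      · have := h1 x hx
        simp [hx]; omega
      · simp [hx]

lemma ind_mono {P : Type*} [PartialOrder P] {I : Set P} (hI : IsUpperSet I) :
    Monotone (Set.indicator I (1 : P → ℕ)) := by
  intro x y hxy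
  by_cases hx : x ∈ I
  · simp [hx, hI hxy hx]
  · simp [hx]

lemma dividesM_ind {P : Type*} [PartialOrder P] {I S : Set P} (hI : IsUpperSet I)
    (hS : IsUpperSet S) :
    DividesM (Set.indicator I (1 : P → ℕ)) (Set.indicator S (1 : P → ℕ)) ↔
      I ⊆ S ∧ IsUpperSet (S \ I) := by
  rw [dividesM_iff hI (ind_mono hS)]
  constructor
  · rintro ⟨h1, h2⟩
    refine ⟨fun y hy => ?_, fun x y hxy hx => ⟨hS hxy hx.1, fun hy => ?_⟩⟩
    · by_contra h
      simpa [h] using h1 y hy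
    · have := h2 x y hxy hx.2 hy
      simp [hx.1, hS hxy hx.1] at this
  · rintro ⟨h1, h2⟩
    refine ⟨fun y hy => by simp [h1 hy], fun x y hxy hx hy => ?_⟩
    have : x ∉ S := fun h => (h2 hxy ⟨h, hx⟩).2 hy
    simp [this, h1 hy]

lemma irred_eq {P : Type*} [PartialOrder P] {I S : Set P} (hI : IrredUpper I)
    (hS : IrredUpper S)
    (h : DividesM (Set.indicator I (1 : P → ℕ)) (Set.indicator S (1 : P → ℕ))) : S = I := by
  obtain ⟨h1, h2⟩ := (dividesM_ind hI.1 hS.1).1 h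
  by_contra hne
  have : (S \ I).Nonempty := by
    rw [Set.nonempty_iff_ne_empty]
    intro h
    exact hne ((Set.sdiff_eq_empty.1 h).antisymm h1)
  exact hS.2.2 I (S \ I) hI.1 h2 hI.2.1 this Set.disjoint_sdiff_right
    (Set.union_sdiff_cancel h1).symm

lemma irred_sub {P : Type*} [PartialOrder P] {G A B : Set P} (hG : IrredUpper G)
    (hA : IsUpperSet A) (hB : IsUpperSet B) (hd : Disjoint A B) (h : G ⊆ A ∪ B)
    {z : P} (hz : z ∈ G) (hzA : z ∈ A) : G ⊆ A := by
  intro y hy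
  by_contra hyA
  have hyB := (h hy).resolve_left hyA
  refine hG.2.2 (G ∩ A) (G ∩ B) (hG.1.inter hA) (hG.1.inter hB) ⟨z, hz, hzA⟩ ⟨y, hy, hyB⟩
    (hd.mono Set.inter_subset_right Set.inter_subset_right) ?_
  rw [← Set.inter_union_distrib_left, Set.inter_eq_left.2 h]

lemma irred_union {P : Type*} [PartialOrder P] {G H : Set P} (hG : IrredUpper G)
    (hH : IrredUpper H) (hn : (G ∩ H).Nonempty) : IrredUpper (G ∪ H) := by
  refine ⟨hG.1.union hH.1, hG.2.1.mono Set.subset_union_left, ?_⟩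
  intro A B hA hB hAn hBn hd he
  obtain ⟨z, hzG, hzH⟩ := hn
  have hz : z ∈ A ∪ B := he ▸ Or.inl hzG
  have key : ∀ A B : Set P, IsUpperSet A → IsUpperSet B → B.Nonempty → Disjoint A B →
      G ∪ H = A ∪ B → z ∈ A → False := by
    intro A B hA hB hBn hd he hz
    have h1 := irred_sub hG hA hB hd (he ▸ Set.subset_union_left) hzG hz
    have h2 := irred_sub hH hA hB hd (he ▸ Set.subset_union_right) hzH hz
    obtain ⟨b, hb⟩ := hBn
    have : b ∈ G ∪ H := he ▸ Or.inr hb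
    exact Set.disjoint_left.1 hd (Set.union_subset h1 h2 this) hb
  rcases hz with hz | hz
  · exact key A B hA hB hBn hd he hz
  · exact key B A hB hA hAn hd.symm (by rw [he, Set.union_comm]) hz

lemma irred_Ici {P : Type*} [PartialOrder P] (p : P) : IrredUpper (Set.Ici p) := by
  refine ⟨isUpperSet_Ici p, ⟨p, le_rfl⟩, ?_⟩
  intro A B hA hB hAn hBn hd he
  have hp : p ∈ A ∪ B := he ▸ (le_rfl : p ≤ p)
  obtain ⟨a, ha⟩ := hAn
  obtain ⟨b, hb⟩ := hBn
  have ha' : p ≤ a := (he.symm ▸ Or.inl ha : a ∈ Set.Ici p)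
  have hb' : p ≤ b := (he.symm ▸ Or.inr hb : b ∈ Set.Ici p)
  rcases hp with hp | hp
  · exact Set.disjoint_left.1 hd (hA hb' hp) hb
  · exact Set.disjoint_left.1 hd ha (hB ha' hp)

lemma exists_min {P : Type*} [Fintype P] [PartialOrder P] {I : Set P} (hI : IrredUpper I)
    (h : ∀ G H : Set P, IrredUpper G → IrredUpper H → G ≠ I → H ≠ I → G ∪ H ≠ I) :
    ∃ p, I = Set.Ici p := by
  by_contra! hne
  obtain ⟨q, hq⟩ := hI.2.1
  have hs : ∀ y ∈ I, Set.Ici y ⊆ I := fun y hy z hz => hI.1 hz hy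
  obtain ⟨G, hG⟩ := (Set.toFinite {G : Set P | IrredUpper G ∧ G ⊆ I ∧ G ≠ I}).exists_maximal
    ⟨Set.Ici q, irred_Ici q, hs q hq, (hne q).symm⟩
  obtain ⟨⟨hGi, hGI, hGn⟩, hmax⟩ := hG
  have key : ∀ y ∈ I, y ∉ G → Disjoint (Set.Ici y) G := by
    intro y hy hyG
    by_contra hd
    rw [Set.disjoint_iff_inter_eq_empty, ← ne_eq, ← Set.nonempty_iff_ne_empty,
      Set.inter_comm] at hd
    have hu := irred_union hGi (irred_Ici y) hd
    have := hmax ⟨hu, Set.union_subset hGI (hs y hy), h G _ hGi (irred_Ici y) hGn (hne y).symm⟩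
      Set.subset_union_left
    exact hyG (this (Or.inr (le_rfl : y ≤ y)))
  have hup : IsUpperSet (I \ G) := fun x y hxy hx =>
    ⟨hI.1 hxy hx.1, fun hy => Set.disjoint_left.1 (key x hx.1 hx.2) hxy hy⟩
  exact hGn (irred_eq hGi hI ((dividesM_ind hGi.1 hI.1).2 ⟨hGI, hup⟩)).symm

theorem stmt9 {P : Type*} [Fintype P] [PartialOrder P]
    (I : Set P) (hI : IrredUpper I) :
    PrimeM (Set.indicator I (1 : P → ℕ)) ↔
      ((∀ G H : Set P, IrredUpper G → IrredUpper H → G ≠ I → H ≠ I →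
        ¬ DividesM (Set.indicator I (1 : P → ℕ)) (Set.indicator (G ∪ H) (1 : P → ℕ)) ∧
        ¬ DividesM (Set.indicator I (1 : P → ℕ)) (Set.indicator (G ∩ H) (1 : P → ℕ))) ∧
      (∀ J : Set P, IrredUpper J → J ≠ I → I ⊆ J ∨ J ⊆ I ∨ I ∩ J = ∅)) := by
  constructor
  · rintro ⟨-, -, hp⟩
    have hsum : ∀ G H : Set P, Set.indicator G (1 : P → ℕ) + Set.indicator H (1 : P → ℕ) =
        Set.indicator (G ∪ H) (1 : P → ℕ) + Set.indicator (G ∩ H) (1 : P → ℕ) :=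
      fun G H => (Set.indicator_union_add_inter _ _ _).symm
    have hadd : ∀ a b c : P → ℕ, Monotone c → DividesM a b → DividesM a (b + c) := by
      rintro a b c hc ⟨d, hd, rfl⟩
      exact ⟨d + c, hd.add hc, add_assoc _ _ _⟩
    refine ⟨fun G H hG hH hGI hHI => ?_, fun J hJ hJI => ?_⟩
    · have key : ¬ DividesM (Set.indicator I (1 : P → ℕ))
          (Set.indicator G (1 : P → ℕ) + Set.indicator H (1 : P → ℕ)) := by
        intro h
        rcases hp _ _ (ind_mono hG.1) (ind_mono hH.1) h with h | h
        · exact hGI (irred_eq hI hG h)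
        · exact hHI (irred_eq hI hH h)
      refine ⟨fun h => key ?_, fun h => key ?_⟩
      · rw [hsum]
        exact hadd _ _ _ (ind_mono (hG.1.inter hH.1)) h
      · rw [hsum, add_comm]
        exact hadd _ _ _ (ind_mono (hG.1.union hH.1)) h
    · by_cases hn : I ∩ J = ∅
      · exact Or.inr (Or.inr hn)
      have hn' := Set.nonempty_iff_ne_empty.2 hn
      have h : DividesM (Set.indicator I (1 : P → ℕ))
          (Set.indicator (I ∪ J) (1 : P → ℕ) + Set.indicator (I ∩ J) (1 : P → ℕ)) := by
        rw [← hsum]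
        exact ⟨_, ind_mono hJ.1, rfl⟩
      rcases hp _ _ (ind_mono (hI.1.union hJ.1)) (ind_mono (hI.1.inter hJ.1)) h with h | h
      · have := irred_eq hI (irred_union hI hJ hn') h
        exact Or.inr (Or.inl (this ▸ Set.subset_union_right))
      · have := ((dividesM_ind hI.1 (hI.1.inter hJ.1)).1 h).1
        exact Or.inl (this.trans Set.inter_subset_right)
  · rintro ⟨h1, h2⟩
    have hU := hI.1
    obtain ⟨p, hp⟩ := exists_min hI (by
      intro G H hG hH hGI hHI he
      refine (h1 G H hG hH hGI hHI).1 ?_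
      rw [he]
      exact ⟨0, fun _ _ _ => le_rfl, by simp⟩)
    have hpI : p ∈ I := hp ▸ (le_rfl : p ≤ p)
    have hle : ∀ y ∈ I, p ≤ y := fun y hy => by rw [hp] at hy; exact hy
    have hlt : ∀ x y, x ≤ y → x ∉ I → y ∈ I → x < p := by
      intro x y hxy hx hy
      have hxi : Set.Ici x ≠ I := fun h => hx (h ▸ (le_rfl : x ≤ x))
      refine lt_of_le_of_ne ?_ (fun h => hx (h ▸ hpI))
      rcases h2 _ (irred_Ici x) hxi with h | h | h
      · exact h hpI
      · exact absurd (h (le_rfl : x ≤ x)) hx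
      · exact absurd (show y ∈ I ∩ Set.Ici x from ⟨hy, hxy⟩) (by simp [h])
    have hnot : ∀ x, x < p → x ∉ I := fun x hx h => absurd (hle x h) (not_le_of_gt hx)
    have hdiv : ∀ g : P → ℕ, Monotone g → (DividesM (Set.indicator I (1 : P → ℕ)) g ↔
        1 ≤ g p ∧ ∀ x, x < p → g x < g p) := by
      intro g hg
      rw [dividesM_iff hU hg]
      constructor
      · rintro ⟨ha, hb⟩
        exact ⟨ha p hpI, fun x hx => hb x p hx.le (hnot x hx) hpI⟩
      · rintro ⟨ha, hb⟩
        exact ⟨fun y hy => ha.trans (hg (hle y hy)), fun x y hxy hx hy =>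
          (hb x (hlt x y hxy hx hy)).trans_le (hg (hle y hy))⟩
    refine ⟨ind_mono hU, fun h => by simpa [hpI] using congrFun h p, ?_⟩
    intro g h hg hh hgh
    rw [hdiv (g + h) (hg.add hh)] at hgh
    rw [hdiv _ hg, hdiv _ hh]
    obtain ⟨hs1, hs2⟩ := hgh
    simp only [Pi.add_apply] at hs1 hs2
    by_cases hmin : ∃ a, a < p
    · obtain ⟨a0, ha0⟩ := hmin
      have aux : ∀ g : P → ℕ, Monotone g → ¬ (1 ≤ g p ∧ ∀ x, x < p → g x < g p) →
          ∃ a, a < p ∧ g a = g p := by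
        intro g hg hn
        by_contra! hc
        have hl : ∀ x, x < p → g x < g p := fun x hx => lt_of_le_of_ne (hg hx.le) (hc x hx)
        have := hl a0 ha0
        exact hn ⟨by omega, hl⟩
      by_contra! hcon
      obtain ⟨a, hap, hga⟩ := aux g hg (fun h => by
        obtain ⟨x, hx, hx'⟩ := hcon.1 h.1
        exact absurd (h.2 x hx) (not_lt_of_ge hx'))
      obtain ⟨c, hcp, hhc⟩ := aux h hh (fun h => by
        obtain ⟨x, hx, hx'⟩ := hcon.2 h.1
        exact absurd (h.2 x hx) (not_lt_of_ge hx'))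
      have hne : ∀ x, x < p → Set.Ici x ≠ I := fun x hx he =>
        hnot x hx (he ▸ (le_rfl : x ≤ x))
      refine (h1 _ _ (irred_Ici a) (irred_Ici c) (hne a hap) (hne c hcp)).2 ?_
      rw [dividesM_ind hU ((isUpperSet_Ici a).inter (isUpperSet_Ici c))]
      refine ⟨fun y hy => ⟨hap.le.trans (hle y hy), hcp.le.trans (hle y hy)⟩, ?_⟩
      rintro x y hxy ⟨⟨hx1, hx2⟩, hx⟩
      refine ⟨⟨le_trans hx1 hxy, le_trans hx2 hxy⟩, fun hy => ?_⟩
      have hs := hs2 x (hlt x y hxy hx hy)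
      have e1 := hg hx1
      have e2 := hh hx2
      omega
    · push Not at hmin
      rcases Nat.eq_zero_or_pos (g p) with h0 | h0
      · exact Or.inr ⟨by omega, fun x hx => absurd hx (hmin x)⟩
      · exact Or.inl ⟨h0, fun x hx => absurd hx (hmin x)⟩
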